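/- arXiv:1802.09673 — 4 statements merged into one kernel-verified Lean document; each statement's English description precedes it below -/
import Mathlib

section
/- Let N, m, c be integers with 1 ≤ c ≤ m < N, c ≤ N − m, and N ≥ 2c + 1. Then the maximum negative hypergeometric probability mass function satisfies f_{N,m,c}(0) / f_{N,m,c}(1) = (c+1)/c, i.e., c · f_{N,m,c}(0) = (c+1) · f_{N,m,c}(1); in particular the distribution always has a local mode at Y = 0. -/
/-- The maximum negative hypergeometric probability mass function. -/
def maxNegHyperPMF (N m c y : ℕ) : ℚ :=
  ((c : ℚ) / (2*c + y)) *
    (((m.choose (c + y) : ℚ) * ((N - m).choose c : ℚ)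
      + (m.choose c : ℚ) * ((N - m).choose (c + y) : ℚ))
    / (N.choose (2*c + y) : ℚ))

lemma Nat.cast_choose_succ_mul {n k : ℕ} (h : k ≤ n) :
    (n.choose (k + 1) : ℚ) * (k + 1) = n.choose k * (n - k) := by
  have := Nat.choose_succ_right_eq n k
  rw [← Nat.cast_sub h]
  exact_mod_cast this

/-- `f(0)/f(1) = (c+1)/c`: there is always a local mode at `Y = 0`. -/
theorem maxNegHyper_mode_at_zero (N m c : ℕ)
    (hc : 1 ≤ c) (hcm : c ≤ m) (hmN : m < N) (hcNm : c ≤ N - m)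
    (hN : 2*c + 1 ≤ N) :
    (c : ℚ) * maxNegHyperPMF N m c 0 = ((c : ℚ) + 1) * maxNegHyperPMF N m c 1 := by
  have hm := Nat.cast_choose_succ_mul hcm
  have hn := Nat.cast_choose_succ_mul hcNm
  have hD := Nat.cast_choose_succ_mul (show 2 * c ≤ N by omega)
  have hD₀ : (N.choose (2 * c) : ℚ) ≠ 0 := by
    exact_mod_cast (Nat.choose_pos (by omega)).ne'
  have hD₁ : (N.choose (2 * c + 1) : ℚ) ≠ 0 := by
    exact_mod_cast (Nat.choose_pos hN).ne'
  have hc₀ : (c : ℚ) ≠ 0 := by exact_mod_cast (by omega : c ≠ 0)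
  have hc₁ : (2 * c + 1 : ℚ) ≠ 0 := by positivity
  rw [Nat.cast_sub hmN.le] at hn
  push_cast at hD
  simp only [maxNegHyperPMF, Nat.cast_zero, Nat.cast_one, add_zero]
  generalize (N.choose (2 * c) : ℚ) = D at *
  generalize (N.choose (2 * c + 1) : ℚ) = D' at *
  generalize (m.choose c : ℚ) = A at *
  generalize (m.choose (c + 1) : ℚ) = A' at *
  generalize ((N - m).choose c : ℚ) = B at *
  generalize ((N - m).choose (c + 1) : ℚ) = B' at *
  field_simp
  linear_combination 2 * (A * B * hD - D * B * hm - D * A * hn)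
end

section
/- Let N, m, c be integers with 1 ≤ c ≤ m < N and c ≤ N − m. Then the maximum negative hypergeometric probability mass function sums to one: Σ_{y=0}^{max(m−c, N−m−c)} f_{N,m,c}(y) = 1. -/
theorem Nat.cast_choose_succ_mul_succ (n k : ℕ) :
    (n.choose (k + 1) : ℚ) * (k + 1) = n.choose k * (n - k) := by
  rcases le_or_gt k n with h | h
  · rw [← Nat.cast_sub h]
    exact_mod_cast Nat.choose_succ_right_eq n k
  · simp [Nat.choose_eq_zero_of_lt h, Nat.choose_eq_zero_of_lt (h.trans (Nat.lt_succ_self k))]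

/-- The probability that `k` draws without replacement from `m` red and `n` white balls contain
fewer than `c` red balls. -/
def hyperLowerTail (m n c k : ℕ) : ℚ :=
  ∑ j ∈ Finset.range c, ((m.choose j : ℚ) * (n.choose (k - j) : ℚ)) / ((m + n).choose k : ℚ)

/-- The lower tail drops by the probability that the `c`-th red ball appears at draw `k + 1`. -/
theorem hyperLowerTail_sub_succ (m n c k : ℕ) (hk : k < m + n) (hck : c ≤ k + 1) :
    hyperLowerTail m n c k - hyperLowerTail m n c (k + 1) =
      (c : ℚ) / (k + 1) * ((m.choose c : ℚ) * (n.choose (k + 1 - c) : ℚ)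
        / ((m + n).choose (k + 1) : ℚ)) := by
  induction c with
  | zero => simp [hyperLowerTail]
  | succ c ih =>
    specialize ih (by omega)
    obtain ⟨i, rfl⟩ : ∃ i, k = c + i := ⟨k - c, by omega⟩
    simp only [hyperLowerTail, Finset.sum_range_succ] at ih ⊢
    have e₁ : c + i + 1 - c = i + 1 := by omega
    have e₂ : c + i + 1 - (c + 1) = i := by omega
    have e₃ : c + i - c = i := by omega
    rw [e₁] at ih ⊢
    rw [e₂, e₃]
    have hN := Nat.cast_choose_succ_mul_succ (m + n) (c + i)
    have hm := Nat.cast_choose_succ_mul_succ m c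
    have hn := Nat.cast_choose_succ_mul_succ n i
    have hpos : ((m + n).choose (c + i) : ℚ) ≠ 0 :=
      Nat.cast_ne_zero.2 (Nat.choose_pos hk.le).ne'
    have hpos' : ((m + n).choose (c + i + 1) : ℚ) ≠ 0 :=
      Nat.cast_ne_zero.2 (Nat.choose_pos hk).ne'
    have hki : ((c : ℚ) + i + 1) ≠ 0 := by positivity
    push_cast at ih hN ⊢
    have hstep : (m.choose c : ℚ) * n.choose i / (m + n).choose (c + i)
        - (m.choose c : ℚ) * n.choose (i + 1) / (m + n).choose (c + i + 1)
        = ((c : ℚ) + 1) / (c + i + 1)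
            * (m.choose (c + 1) * n.choose i / (m + n).choose (c + i + 1))
          - (c : ℚ) / (c + i + 1)
            * (m.choose c * n.choose (i + 1) / (m + n).choose (c + i + 1)) := by
      field_simp
      linear_combination (m.choose c : ℚ) * n.choose i * hN
        - ((m + n).choose (c + i) : ℚ) * n.choose i * hm
        - ((m + n).choose (c + i) : ℚ) * m.choose c * hn
    linear_combination ih + hstep

/-- After `2 * c - 1` draws exactly one of the two colours has been drawn fewer than `c` times. -/
theorem hyperLowerTail_add_swap (m n d : ℕ) (h : 2 * d + 1 ≤ m + n) :
    hyperLowerTail m n (d + 1) (2 * d + 1) + hyperLowerTail n m (d + 1) (2 * d + 1) = 1 := by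
  have hpos : ((m + n).choose (2 * d + 1) : ℚ) ≠ 0 :=
    Nat.cast_ne_zero.2 (Nat.choose_pos h).ne'
  have hv := Nat.add_choose_eq m n (2 * d + 1)
  rw [Finset.Nat.sum_antidiagonal_eq_sum_range_succ (fun i j => m.choose i * n.choose j),
    show (2 * d + 1).succ = (d + 1) + (d + 1) by omega, Finset.sum_range_add,
    ← Finset.sum_range_reflect (fun x => m.choose (d + 1 + x) * _)] at hv
  have hr : ∑ j ∈ Finset.range (d + 1), m.choose (d + 1 + (d + 1 - 1 - j))
        * n.choose (2 * d + 1 - (d + 1 + (d + 1 - 1 - j)))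
      = ∑ j ∈ Finset.range (d + 1), n.choose j * m.choose (2 * d + 1 - j) := by
    refine Finset.sum_congr rfl fun j hj => ?_
    have hj := Finset.mem_range.1 hj
    rw [mul_comm]
    congr 2 <;> omega
  rw [hr] at hv
  unfold hyperLowerTail
  rw [add_comm n m, ← Finset.sum_div, ← Finset.sum_div, ← add_div, div_eq_one_iff_eq hpos]
  exact_mod_cast hv.symm

theorem hyperLowerTail_eq_zero (m n c k : ℕ) (h : c + n ≤ k) : hyperLowerTail m n c k = 0 := by
  refine Finset.sum_eq_zero fun j hj => ?_
  have hj := Finset.mem_range.1 hj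
  simp [Nat.choose_eq_zero_of_lt (show n < k - j by omega)]

/-- The maximum negative hypergeometric pmf sums to one over its range. -/
theorem maxNegHyper_sums_to_one (N m c : ℕ)
    (hc : 1 ≤ c) (hcm : c ≤ m) (hmN : m < N) (hcNm : c ≤ N - m) :
    ∑ y ∈ Finset.range (max (m - c) (N - m - c) + 1), maxNegHyperPMF N m c y = 1 := by
  obtain ⟨n, rfl⟩ : ∃ n, N = m + n := ⟨N - m, by omega⟩
  obtain ⟨d, rfl⟩ : ∃ d, c = d + 1 := ⟨c - 1, by omega⟩
  rw [Nat.add_sub_cancel_left] at hcNm ⊢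
  let F : ℕ → ℚ := fun y =>
    hyperLowerTail m n (d + 1) (2 * d + 1 + y) + hyperLowerTail n m (d + 1) (2 * d + 1 + y)
  have hF : ∀ y ∈ Finset.range (max (m - (d + 1)) (n - (d + 1)) + 1),
      maxNegHyperPMF (m + n) m (d + 1) y = F y - F (y + 1) := by
    intro y hy
    have hy := Finset.mem_range.1 hy
    have h₁ := hyperLowerTail_sub_succ m n (d + 1) (2 * d + 1 + y) (by omega) (by omega)
    have h₂ := hyperLowerTail_sub_succ n m (d + 1) (2 * d + 1 + y) (by omega) (by omega)
    rw [show 2 * d + 1 + y + 1 - (d + 1) = d + 1 + y by omega] at h₁ h₂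
    rw [add_comm n m] at h₂
    simp only [F, maxNegHyperPMF, Nat.add_sub_cancel_left, ← add_assoc]
    rw [show 2 * (d + 1) + y = 2 * d + 1 + y + 1 by omega]
    push_cast at h₁ h₂ ⊢
    rw [show 2 * ((d : ℚ) + 1) + y = 2 * d + 1 + y + 1 by ring]
    linear_combination -h₁ - h₂
  rw [Finset.sum_congr rfl hF, Finset.sum_range_sub']
  simp only [F]
  rw [hyperLowerTail_eq_zero m n _ (2 * d + 1 + (_ + 1)) (by omega),
    hyperLowerTail_eq_zero n m _ (2 * d + 1 + (_ + 1)) (by omega), add_zero, add_zero, sub_zero]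
  exact hyperLowerTail_add_swap m n d (by omega)
end

section
/- Fix an integer c ≥ 1 and a real 0 < p < 1 with q = 1 − p, and let g be the maximum negative binomial probability mass function with parameters c and p. Then g(0)/g(1) = (c+1)/c, i.e., c · g(0) = (c+1) · g(1); in particular the maximum negative binomial distribution always has a local mode at Y = 0, for every value of p. -/
/-- The maximum negative binomial probability mass function. -/
noncomputable def maxNegBinomialPMF (c : ℕ) (p : ℝ) (y : ℕ) : ℝ :=
  ((2*c + y - 1).choose (c - 1) : ℝ) * (p ^ y + (1 - p) ^ y) * (p * (1 - p)) ^ c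

/-- `g(0)/g(1) = (c+1)/c`: the maximum negative binomial distribution always has
a local mode at `Y = 0`, for every value of `p`. -/
theorem maxNegBinomial_mode_at_zero (c : ℕ) (hc : 1 ≤ c)
    (p : ℝ) (hp0 : 0 < p) (hp1 : p < 1) :
    (c : ℝ) * maxNegBinomialPMF c p 0 = ((c : ℝ) + 1) * maxNegBinomialPMF c p 1 := by
  obtain ⟨k, rfl⟩ : ∃ k, c = k + 1 := ⟨c - 1, by omega⟩
  have h := Nat.choose_mul_succ_eq (2 * k + 1) k
  rw [show 2 * k + 1 + 1 - k = k + 2 by omega] at h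
  have hR : ((2 * k + 1).choose k : ℝ) * (2 * k + 2) = ((2 * k + 2).choose k : ℝ) * (k + 2) := by
    exact_mod_cast h
  simp only [maxNegBinomialPMF, show 2 * (k + 1) + 0 - 1 = 2 * k + 1 by omega,
    show 2 * (k + 1) + 1 - 1 = 2 * k + 2 by omega, Nat.add_sub_cancel, Nat.cast_add, Nat.cast_one]
  linear_combination (p * (1 - p)) ^ (k + 1) * hR
end

section
/- Let N, c be integers with c ≥ 1 and let y ∈ {0, 1}, with 2(c + y) < N. Then the second derivative of the log-likelihood kernel Λ(x) = log( P_c(x)·P_{c+y}(N − x) + P_{c+y}(x)·P_c(N − x) ) at x = N/2 is strictly negative: Λ″(N/2) < 0. (Hence for observed values y = 0 or y = 1 the maximum likelihood estimate of m is N/2.) -/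
/-- The factorial polynomial `P_k(x) = x(x-1)⋯(x-k+1)`. -/
noncomputable def factPoly (k : ℕ) (x : ℝ) : ℝ :=
  ∏ i ∈ Finset.range k, (x - i)

/-- The log-likelihood kernel of the maximum negative hypergeometric distribution
as a function of a real parameter `x`. -/
noncomputable def maxNegHyperLogLik (N c y : ℕ) (x : ℝ) : ℝ :=
  Real.log (factPoly c x * factPoly (c + y) ((N : ℝ) - x)
    + factPoly (c + y) x * factPoly c ((N : ℝ) - x))

theorem factPoly_succ (k : ℕ) (x : ℝ) : factPoly (k + 1) x = factPoly k x * (x - k) :=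
  Finset.prod_range_succ _ _

theorem sub_natCast_pos {c i : ℕ} {x : ℝ} (hx : (c : ℝ) < x) (hi : i ∈ Finset.range c) :
    0 < x - i := by
  have : (i : ℝ) < c := by exact_mod_cast Finset.mem_range.mp hi
  linarith

theorem factPoly_pos {c : ℕ} {x : ℝ} (hx : (c : ℝ) < x) : 0 < factPoly c x :=
  Finset.prod_pos fun _ hi => sub_natCast_pos hx hi

theorem log_factPoly {c : ℕ} {x : ℝ} (hx : (c : ℝ) < x) :
    Real.log (factPoly c x) = ∑ i ∈ Finset.range c, Real.log (x - i) :=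
  Real.log_prod fun _ hi => (sub_natCast_pos hx hi).ne'

/-- For `y ∈ {0, 1}` the kernel is a constant plus a sum of logarithms of affine functions. -/
theorem exists_maxNegHyperLogLik_eq {N c y : ℕ} (hy : y = 0 ∨ y = 1) (hN : 2 * (c + y) < N) :
    ∃ K : ℝ, ∀ x ∈ Set.Ioo (c : ℝ) (N - c), maxNegHyperLogLik N c y x =
      K + ∑ i ∈ Finset.range c, (Real.log (x - i) + Real.log (N - x - i)) := by
  obtain ⟨a, ha, h⟩ : ∃ a : ℝ, 0 < a ∧ ∀ x : ℝ,
      factPoly c x * factPoly (c + y) (N - x) + factPoly (c + y) x * factPoly c (N - x) =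
        a * (factPoly c x * factPoly c (N - x)) := by
    rcases hy with rfl | rfl
    · exact ⟨2, two_pos, fun x => by simp only [add_zero]; ring⟩
    · refine ⟨N - 2 * c, ?_, fun x => by simp only [factPoly_succ]; ring⟩
      have : (2 * (c + 1) : ℝ) < N := by exact_mod_cast hN
      linarith
  refine ⟨Real.log a, fun x hx => ?_⟩
  have hx' : (c : ℝ) < N - x := by linarith [hx.2]
  have h₁ := factPoly_pos hx.1
  have h₂ := factPoly_pos hx'
  rw [maxNegHyperLogLik, h, Real.log_mul ha.ne' (mul_pos h₁ h₂).ne',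
    Real.log_mul h₁.ne' h₂.ne', log_factPoly hx.1, log_factPoly hx', Finset.sum_add_distrib]

theorem hasDerivAt_maxNegHyperLogLik {N c y : ℕ} (hy : y = 0 ∨ y = 1) (hN : 2 * (c + y) < N)
    {x : ℝ} (hx : x ∈ Set.Ioo (c : ℝ) (N - c)) :
    HasDerivAt (maxNegHyperLogLik N c y)
      (∑ i ∈ Finset.range c, ((x - i)⁻¹ - (N - x - i)⁻¹)) x := by
  obtain ⟨K, hK⟩ := exists_maxNegHyperLogLik_eq hy hN
  have hx' : (c : ℝ) < N - x := by linarith [hx.2]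
  refine HasDerivAt.congr_of_eventuallyEq ?_
    (Filter.eventuallyEq_of_mem (isOpen_Ioo.mem_nhds hx) hK)
  refine HasDerivAt.const_add K (HasDerivAt.fun_sum fun i hi => ?_)
  have h₁ := ((hasDerivAt_id' x).sub_const (i : ℝ)).log (sub_natCast_pos hx.1 hi).ne'
  have h₂ := (((hasDerivAt_id' x).const_sub (N : ℝ)).sub_const (i : ℝ)).log
    (sub_natCast_pos hx' hi).ne'
  exact (h₁.fun_add h₂).congr_deriv (by ring)

theorem hasDerivAt_sum_inv_sub_inv {N c : ℕ} {x : ℝ} (hx : x ∈ Set.Ioo (c : ℝ) (N - c)) :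
    HasDerivAt (fun x : ℝ => ∑ i ∈ Finset.range c, ((x - i)⁻¹ - (N - x - i)⁻¹))
      (∑ i ∈ Finset.range c, (-1 / (x - i) ^ 2 - 1 / (N - x - i) ^ 2)) x := by
  have hx' : (c : ℝ) < N - x := by linarith [hx.2]
  refine HasDerivAt.fun_sum fun i hi => ?_
  have h₁ := ((hasDerivAt_id' x).sub_const (i : ℝ)).fun_inv (sub_natCast_pos hx.1 hi).ne'
  have h₂ := (((hasDerivAt_id' x).const_sub (N : ℝ)).sub_const (i : ℝ)).fun_inv
    (sub_natCast_pos hx' hi).ne'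
  exact (h₁.fun_sub h₂).congr_deriv (by rw [neg_neg])

/-- For observed values `y = 0` or `y = 1`, the second derivative of the
log-likelihood at `N/2` is strictly negative, so the maximum likelihood
estimate of `m` is `N/2`. -/
theorem maxNegHyperLogLik_secondDeriv_neg (N c y : ℕ)
    (hc : 1 ≤ c) (hy : y = 0 ∨ y = 1) (hN : 2 * (c + y) < N) :
    iteratedDeriv 2 (maxNegHyperLogLik N c y) ((N : ℝ) / 2) < 0 := by
  have hNc : (2 * c : ℝ) < N := by exact_mod_cast (show 2 * c < N by lia)
  have hx : (N : ℝ) / 2 ∈ Set.Ioo (c : ℝ) (N - c) := ⟨by linarith, by linarith⟩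
  have hx' : (c : ℝ) < N - (N : ℝ) / 2 := by linarith
  have hderiv := Filter.eventuallyEq_of_mem (isOpen_Ioo.mem_nhds hx)
    fun _ hz => (hasDerivAt_maxNegHyperLogLik hy hN hz).deriv
  rw [iteratedDeriv_succ, iteratedDeriv_one, hderiv.deriv_eq,
    (hasDerivAt_sum_inv_sub_inv hx).deriv]
  refine Finset.sum_neg (fun i hi => ?_) ⟨0, Finset.mem_range.mpr hc⟩
  have h₁ := one_div_pos.mpr (pow_pos (sub_natCast_pos hx.1 hi) 2)
  have h₂ := one_div_pos.mpr (pow_pos (sub_natCast_pos hx' hi) 2)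
  rw [neg_div]
  linarith
end
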